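/- Let d ∈ {1, …, n}, s ∈ {1, −1}, f ∈ A^{⊗n}, and set T := s·t_d + f·x_d ∈ A^{⊗n}. An element X ∈ A^{⊗n} satisfies T·X + X·T = 0 if and only if there exists g ∈ A^{⊗n} with X = g·x_d, i.e., if and only if X lies in the left ideal A^{⊗n}·x_d. -/

import Mathlib

open scoped TensorProduct

noncomputable section

/-- The free `ℤ`-algebra on two generators `ι 0` (playing the role of `t`)
and `ι 1` (playing the role of `x`). -/
abbrev FreeTwo : Type := FreeAlgebra ℤ (Fin 2)

/-- The relations `t² = q`, `t·x = −x·t`, `x² = 0`. -/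
inductive ARel (q : ℕ) : FreeTwo → FreeTwo → Prop
  | t_sq : ARel q (FreeAlgebra.ι ℤ (0 : Fin 2) * FreeAlgebra.ι ℤ (0 : Fin 2)) (q : FreeTwo)
  | t_x : ARel q (FreeAlgebra.ι ℤ (0 : Fin 2) * FreeAlgebra.ι ℤ (1 : Fin 2))
      (-(FreeAlgebra.ι ℤ (1 : Fin 2) * FreeAlgebra.ι ℤ (0 : Fin 2)))
  | x_sq : ARel q (FreeAlgebra.ι ℤ (1 : Fin 2) * FreeAlgebra.ι ℤ (1 : Fin 2)) 0

/-- The ring `A`: the quotient of the free `ℤ`-algebra on `t, x` by the two-sided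
ideal generated by `t² − q`, `t·x + x·t`, `x²`. -/
abbrev A (q : ℕ) : Type := RingQuot (ARel q)

/-- The generator `t` of `A`. -/
def tA (q : ℕ) : A q := RingQuot.mkRingHom (ARel q) (FreeAlgebra.ι ℤ (0 : Fin 2))

/-- The generator `x` of `A`. -/
def xA (q : ℕ) : A q := RingQuot.mkRingHom (ARel q) (FreeAlgebra.ι ℤ (1 : Fin 2))

/-- The `n`-fold tensor power `A^{⊗ n}` over `ℤ`, a ring with componentwise
multiplication. -/
abbrev Tpow (q n : ℕ) : Type := ⨂[ℤ] (_ : Fin n), A q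

/-- `t_i ∈ A^{⊗ n}`, the image of `t` under the `i`-th inclusion `A → A^{⊗ n}`. -/
def tI (q n : ℕ) (i : Fin n) : Tpow q n :=
  PiTensorProduct.tprod ℤ (fun j => if j = i then tA q else 1)

/-- `x_i ∈ A^{⊗ n}`, the image of `x` under the `i`-th inclusion `A → A^{⊗ n}`. -/
def xI (q n : ℕ) (i : Fin n) : Tpow q n :=
  PiTensorProduct.tprod ℤ (fun j => if j = i then xA q else 1)

theorem tA_mul_tA (q : ℕ) : tA q * tA q = (q : A q) := by
  simpa [tA] using RingQuot.mkRingHom_rel (ARel.t_sq (q := q))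

theorem tA_mul_xA (q : ℕ) : tA q * xA q = -(xA q * tA q) := by
  simpa [tA, xA] using RingQuot.mkRingHom_rel (ARel.t_x (q := q))

theorem xA_mul_xA (q : ℕ) : xA q * xA q = 0 := by
  simpa [xA] using RingQuot.mkRingHom_rel (ARel.x_sq (q := q))

/-- The universal property of `A`. -/
def liftA (q : ℕ) {R : Type*} [Ring R] (t x : R) (htt : t * t = q) (htx : t * x = -(x * t))
    (hxx : x * x = 0) : A q →ₐ[ℤ] R :=
  (RingQuot.lift ⟨(FreeAlgebra.lift ℤ ![t, x] : FreeTwo →ₐ[ℤ] R).toRingHom, by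
    rintro _ _ (_ | _ | _) <;> simp [htt, htx, hxx]⟩).toIntAlgHom

section liftA

variable (q : ℕ) {R : Type*} [Ring R] (t x : R) (htt : t * t = q) (htx : t * x = -(x * t))
  (hxx : x * x = 0)

@[simp]
theorem liftA_tA : liftA q t x htt htx hxx (tA q) = t :=
  (RingQuot.lift_mkRingHom_apply _ _ _).trans (by simp)

@[simp]
theorem liftA_xA : liftA q t x htt htx hxx (xA q) = x :=
  (RingQuot.lift_mkRingHom_apply _ _ _).trans (by simp)

end liftA

/-- The multiplication table of `1, t, x, t·x`. -/
theorem normalForm_mul {R : Type*} [Ring R] {q : ℕ} {t x : R} (htt : t * t = q)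
    (htx : t * x = -(x * t)) (hxx : x * x = 0) (b₀ b₁ b₂ b₃ c₀ c₁ c₂ c₃ : ℤ) :
    ((b₀ + b₁ * t + (b₂ + b₃ * t) * x) * (c₀ + c₁ * t + (c₂ + c₃ * t) * x) : R) =
      (b₀ * c₀ + q * b₁ * c₁ : ℤ) + (b₀ * c₁ + b₁ * c₀ : ℤ) * t +
        ((b₀ * c₂ + q * b₁ * c₃ + b₂ * c₀ - q * b₃ * c₁ : ℤ) +
          (b₀ * c₃ + b₁ * c₂ + b₃ * c₀ - b₂ * c₁ : ℤ) * t) * x := by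
  have h0 : t * t = (q : ℤ) • (1 : R) := by simp [htt]
  have h1 : x * t = -(t * x) := by rw [htx, neg_neg]
  have h2 (y : R) : t * (t * y) = (q : ℤ) • y := by rw [← mul_assoc, h0, smul_one_mul]
  have h3 (y : R) : x * (t * y) = -(t * (x * y)) := by rw [← mul_assoc, h1, neg_mul, mul_assoc]
  simp only [← zsmul_one (R := R), mul_add, add_mul, mul_assoc, mul_smul_comm, smul_mul_assoc,
    one_mul, mul_one, h0, h1, h2, h3, hxx, mul_neg, mul_zero, smul_zero, smul_neg, neg_zero]
  module

/-- Every element of `A` is a combination of `1, t, x, t·x`. -/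
theorem exists_normalForm (q : ℕ) (a : A q) : ∃ c : Fin 4 → ℤ,
    a = c 0 + c 1 * tA q + (c 2 + c 3 * tA q) * xA q := by
  obtain ⟨w, rfl⟩ := RingQuot.mkRingHom_surjective (ARel q) a
  induction w using FreeAlgebra.induction with
  | grade0 r => exact ⟨![r, 0, 0, 0], by simp⟩
  | grade1 i =>
    fin_cases i
    · exact ⟨![0, 1, 0, 0], by simp [tA]⟩
    · exact ⟨![0, 0, 1, 0], by simp [xA]⟩
  | add u v hu hv =>
    obtain ⟨b, hb⟩ := hu
    obtain ⟨c, hc⟩ := hv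
    exact ⟨b + c, by rw [map_add, hb, hc]; simp only [Pi.add_apply]; push_cast; noncomm_ring⟩
  | mul u v hu hv =>
    obtain ⟨b, hb⟩ := hu
    obtain ⟨c, hc⟩ := hv
    refine ⟨![b 0 * c 0 + q * b 1 * c 1, b 0 * c 1 + b 1 * c 0,
      b 0 * c 2 + q * b 1 * c 3 + b 2 * c 0 - q * b 3 * c 1,
      b 0 * c 3 + b 1 * c 2 + b 3 * c 0 - b 2 * c 1], ?_⟩
    rw [map_mul, hb, hc, normalForm_mul (tA_mul_tA q) (tA_mul_xA q) (xA_mul_xA q)]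
    simp

/-- The elements `1, t, x, t·x` of `A` are linearly independent over `ℤ`. -/
theorem eq_zero_of_normalForm_eq_zero (q : ℕ) (c : Fin 4 → ℤ)
    (h : c 0 + c 1 * tA q + (c 2 + c 3 * tA q) * xA q = 0) : c = 0 := by
  let ρ := liftA q (R := Matrix (Fin 2) (Fin 2) (ℤ√q))
    !![Zsqrtd.sqrtd, 0; 0, -Zsqrtd.sqrtd] !![0, 1; 0, 0]
    (by
      rw [Matrix.mul_fin_two, ← Matrix.diagonal_natCast]
      refine Matrix.ext fun i j => ?_
      fin_cases i <;> fin_cases j <;> simp)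
    (by simp)
    (by
      refine Matrix.ext fun i j => ?_
      fin_cases i <;> fin_cases j <;> simp)
  have h' := congrArg ρ h
  simp [ρ] at h'
  have h0 := congrFun (congrFun h' 0) 0
  have h1 := congrFun (congrFun h' 0) 1
  simp [Matrix.mul_apply, Matrix.intCast_apply] at h0 h1
  have e0 := congrArg Zsqrtd.re h0
  have e1 := congrArg Zsqrtd.im h0
  have e2 := congrArg Zsqrtd.re h1
  have e3 := congrArg Zsqrtd.im h1
  simp at e0 e1 e2 e3
  funext i
  fin_cases i <;> assumption

theorem free_A (q : ℕ) : Module.Free ℤ (A q) := by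
  let φ : (Fin 4 → ℤ) →ₗ[ℤ] A q :=
    Fintype.linearCombination ℤ ![1, tA q, xA q, tA q * xA q]
  have hφ : ∀ c, φ c = c 0 + c 1 * tA q + (c 2 + c 3 * tA q) * xA q := by
    intro c
    simp [φ, Fintype.linearCombination_apply, Fin.sum_univ_four, add_mul, mul_assoc, add_assoc]
  refine Module.Free.of_equiv (LinearEquiv.ofBijective φ ⟨?_, ?_⟩)
  · rw [← LinearMap.ker_eq_bot, LinearMap.ker_eq_bot']
    intro c hc
    exact eq_zero_of_normalForm_eq_zero q c (by rw [← hφ, hc])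
  · intro a
    obtain ⟨c, hc⟩ := exists_normalForm q a
    exact ⟨c, by rw [hφ, hc]⟩

/-- The endomorphism of `A` with `t ↦ t` and `x ↦ 0`. -/
def killX (q : ℕ) : A q →ₐ[ℤ] A q :=
  liftA q (tA q) 0 (tA_mul_tA q) (by simp) (by simp)

@[simp]
theorem killX_tA (q : ℕ) : killX q (tA q) = tA q :=
  liftA_tA ..

@[simp]
theorem killX_xA (q : ℕ) : killX q (xA q) = 0 :=
  liftA_xA ..

theorem killX_commute (q : ℕ) (a : A q) : Commute (tA q) (killX q a) := by
  obtain ⟨c, rfl⟩ := exists_normalForm q a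
  simp

theorem exists_sub_killX (q : ℕ) (a : A q) : ∃ b, a - killX q a = b * xA q := by
  obtain ⟨c, rfl⟩ := exists_normalForm q a
  exact ⟨c 2 + c 3 * tA q, by simp⟩

theorem isAddTorsionFree_piTensorProduct {ι R : Type*} [Finite ι] [CommRing R] [IsAddTorsionFree R]
    {M : ι → Type*} [∀ i, AddCommGroup (M i)] [∀ i, Module R (M i)] [∀ i, Module.Free R (M i)] :
    IsAddTorsionFree (⨂[R] i, M i) :=
  (Basis.piTensorProduct fun i => Module.Free.chooseBasis R (M i)).repr.injective.isAddTorsionFree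
    (Basis.piTensorProduct fun i => Module.Free.chooseBasis R (M i)).repr.toAddMonoidHom

/-- If `P` is a ring endomorphism with kernel `S·x` whose image commutes with `t = P t`, then the
elements anticommuting with `s·t + f·x` are those of `S·x`. -/
theorem anticommute_iff {S : Type*} [Ring S] [IsAddTorsionFree S] (P : S →+* S) {t x : S} {q : ℕ}
    (hq : q ≠ 0) (htt : t * t = q) (htx : t * x = -(x * t)) (hxx : x * x = 0)
    (hPt : P t = t) (hPx : P x = 0) (hcomm : ∀ X, Commute t (P X))
    (hsub : ∀ X, ∃ g, X - P X = g * x) {s : ℤ} (hs : s ≠ 0) (f X : S) :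
    (s • t + f * x) * X + X * (s • t + f * x) = 0 ↔ ∃ g, X = g * x := by
  have hker : ∀ X, P X = 0 → ∃ g, X = g * x := fun X h => by simpa [h] using hsub X
  constructor
  · intro h
    apply hker
    have h' := congrArg P h
    simp only [map_add, map_mul, map_zsmul, hPt, hPx, mul_zero, add_zero, map_zero,
      smul_mul_assoc, mul_smul_comm, ← (hcomm X).eq, ← two_zsmul, smul_smul] at h'
    have h1 : t * P X = 0 := (smul_eq_zero.1 h').resolve_left (by simpa using hs)
    have h2 : q • P X = 0 := by rw [nsmul_eq_mul, ← htt, mul_assoc, h1, mul_zero]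
    exact (smul_eq_zero.1 h2).resolve_left hq
  · rintro ⟨g, rfl⟩
    have hxgx : ∀ k, x * k * x = 0 := fun k => by
      obtain ⟨l, hl⟩ := hker (x * k) (by simp [hPx])
      rw [hl, mul_assoc, hxx, mul_zero]
    obtain ⟨l, hl⟩ := hker (t * g - g * t) (by simp [hPt, (hcomm g).eq])
    have h1 : t * g * x + g * x * t = 0 := by
      have : g * x * t = -(g * t * x) := by rw [mul_assoc g t, htx]; simp [mul_assoc]
      rw [this, ← sub_eq_add_neg, ← sub_mul, hl, mul_assoc, hxx, mul_zero]
    calc _ = s • (t * g * x + g * x * t) + f * (x * g * x) + g * (x * f * x) := by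
          simp only [add_mul, mul_add, smul_mul_assoc, mul_smul_comm, smul_add, mul_assoc]; abel
      _ = 0 := by simp [h1, hxgx]

section

variable {R B ι : Type*} [CommRing R] [Ring B] [Algebra R B] [DecidableEq ι]

variable (R) in
/-- The inclusion of `B` as the factor `d` of `⨂[R] _ : ι, B`. -/
abbrev singleT (d : ι) : B →ₐ[R] ⨂[R] _ : ι, B :=
  PiTensorProduct.singleAlgHom (A := fun _ => B) d

theorem singleT_apply (d : ι) (b : B) :
    singleT R d b = PiTensorProduct.tprod R fun j => if j = d then b else 1 := by
  rw [singleT, PiTensorProduct.singleAlgHom_apply]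
  congr 1
  funext j
  simp [Pi.mulSingle_apply]

/-- The endomorphism of `⨂[R] _ : ι, B` applying `φ` in the factor `d`. -/
def mapAt (d : ι) (φ : B →ₐ[R] B) : (⨂[R] _ : ι, B) →ₐ[R] ⨂[R] _ : ι, B :=
  PiTensorProduct.liftAlgHom ((PiTensorProduct.tprod R).compLinearMap
      fun j => ((if j = d then φ else AlgHom.id R B) : B →ₐ[R] B).toLinearMap)
    (by simp; rfl)
    (fun x y => by simp; rfl)

theorem mapAt_tprod (d : ι) (φ : B →ₐ[R] B) (a : ι → B) :
    mapAt d φ (PiTensorProduct.tprod R a) =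
      PiTensorProduct.tprod R (Function.update a d (φ (a d))) := by
  simp [mapAt]
  congr 1
  funext j
  by_cases h : j = d
  · subst h; simp
  · simp [h]

theorem mapAt_singleT (d : ι) (φ : B →ₐ[R] B) (b : B) :
    mapAt (R := R) d φ (singleT R d b) = singleT R d (φ b) := by
  simp [mapAt_tprod, Pi.mulSingle]

theorem commute_mapAt (d : ι) (φ : B →ₐ[R] B) (b : B) (h : ∀ a, Commute b (φ a))
    (X : ⨂[R] _ : ι, B) : Commute (singleT R d b) (mapAt d φ X) := by
  induction X using PiTensorProduct.induction_on with
  | smul_tprod r a =>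
    rw [map_smul, mapAt_tprod]
    refine Commute.smul_right ?_ r
    refine Commute.tprod (A := fun _ => B) (Pi.commute_iff.2 fun j => ?_)
    by_cases hj : j = d
    · subst hj; simpa using h _
    · simp [hj]
  | add X Y hX hY => rw [map_add]; exact hX.add_right hY

theorem exists_sub_mapAt_eq_mul (d : ι) (φ : B →ₐ[R] B) (b : B) (h : ∀ a, ∃ c, a - φ a = c * b)
    (X : ⨂[R] _ : ι, B) : ∃ g, X - mapAt d φ X = g * singleT R d b := by
  induction X using PiTensorProduct.induction_on with
  | smul_tprod r a =>
    obtain ⟨c, hc⟩ := h (a d)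
    refine ⟨r • PiTensorProduct.tprod R (Function.update a d c), ?_⟩
    rw [map_smul, mapAt_tprod, ← smul_sub, smul_mul_assoc]
    congr 1
    nth_rw 1 [← Function.update_eq_self d a]
    rw [← MultilinearMap.map_update_sub, hc]
    simp
    congr 1
    funext j
    by_cases hj : j = d
    · subst hj; simp
    · simp [hj]
  | add X Y hX hY =>
    obtain ⟨g, hg⟩ := hX
    obtain ⟨k, hk⟩ := hY
    exact ⟨g + k, by rw [map_add, add_mul, ← hg, ← hk]; abel⟩

theorem anticommute_singleT_iff [IsAddTorsionFree R] [Finite ι] (hB : Module.Free R B) (d : ι)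
    (φ : B →ₐ[R] B) {t x : B} {q : ℕ} (hq : q ≠ 0) (htt : t * t = q) (htx : t * x = -(x * t))
    (hxx : x * x = 0) (hφt : φ t = t) (hφx : φ x = 0) (hcomm : ∀ a, Commute t (φ a))
    (hsub : ∀ a, ∃ b, a - φ a = b * x) {s : ℤ} (hs : s ≠ 0) (f X : ⨂[R] _ : ι, B) :
    (s • singleT R d t + f * singleT R d x) * X + X * (s • singleT R d t + f * singleT R d x) = 0 ↔
      ∃ g, X = g * singleT R d x :=
  have := isAddTorsionFree_piTensorProduct (R := R) (M := fun _ : ι => B)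
  anticommute_iff (mapAt d φ : (⨂[R] _ : ι, B) →+* ⨂[R] _ : ι, B) hq
    (by rw [← map_mul, htt, map_natCast])
    (by rw [← map_mul, ← map_mul, ← map_neg, htx])
    (by rw [← map_mul, hxx, map_zero])
    ((mapAt_singleT d φ t).trans (by rw [hφt]))
    ((mapAt_singleT d φ x).trans (by rw [hφx, map_zero]))
    (commute_mapAt d φ t hcomm) (exists_sub_mapAt_eq_mul d φ x hsub) hs f X

end

/-- For `T := ±t_d + f·x_d`, an element `X ∈ A^{⊗ n}` anticommutes with `T`
(`T·X + X·T = 0`) if and only if `X` lies in the left ideal `A^{⊗ n}·x_d`. -/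
theorem stmt17 (q : ℕ) (hq : ¬ IsSquare q) (n : ℕ) (hn : 1 ≤ n)
    (d : Fin n) (s : ℤ) (hs : s = 1 ∨ s = -1) (f : Tpow q n) (X : Tpow q n) :
    (s • tI q n d + f * xI q n d) * X + X * (s • tI q n d + f * xI q n d) = 0 ↔
    ∃ g : Tpow q n, X = g * xI q n d := by
  have ht : tI q n d = singleT ℤ d (tA q) := (singleT_apply d _).symm
  have hx : xI q n d = singleT ℤ d (xA q) := (singleT_apply d _).symm
  rw [ht, hx]
  exact anticommute_singleT_iff (free_A q) d (killX q) (by rintro rfl; simp at hq) (tA_mul_tA q)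
    (tA_mul_xA q) (xA_mul_xA q) (killX_tA q) (killX_xA q) (killX_commute q) (exists_sub_killX q)
    (by rcases hs with rfl | rfl <;> decide) f X
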